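/- arXiv:1909.05699 — 2 statements merged into one kernel-verified Lean document; each statement's English description precedes it below -/
import Mathlib

section
/- Let n ≥ 1 and let f : EuclideanSpace ℝ (Fin n) → ℂ. For a vector of lengthscales φ ∈ (Fin n → ℝ) with φ i > 0 for all i, define the (squared) Gaussian-kernel RKHS norm of f spectrally as the Lebesgue integral with values in [0, ∞]: N φ f := ∫⁻ ω, ‖𝓕 f ω‖² · (∏ i, φ i)⁻¹ · exp ((1/2) · ∑ i, (φ i)² · (ω i)²) dω, where 𝓕 f denotes the Fourier transform of f on EuclideanSpace ℝ (Fin n). Then for any two lengthscale vectors φ, φ' with 0 < φ' i ≤ φ i for all i, one has N φ' f ≤ (∏ i, φ i / φ' i) · N φ f. -/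
open MeasureTheory Real
open scoped FourierTransform ENNReal

/-- The squared RKHS norm of `f` with respect to the Gaussian (squared exponential)
kernel with per-coordinate lengthscales `φ`, expressed spectrally via the Fourier
transform, as a Lebesgue integral with values in `[0, ∞]`. -/
noncomputable def gaussRKHSNormSq {n : ℕ} (φ : Fin n → ℝ)
    (f : EuclideanSpace ℝ (Fin n) → ℂ) : ℝ≥0∞ :=
  ∫⁻ ω : EuclideanSpace ℝ (Fin n),
    (‖𝓕 f ω‖₊ : ℝ≥0∞) ^ 2 *
      ENNReal.ofReal ((∏ i, φ i)⁻¹ * Real.exp ((1 / 2) * ∑ i, (φ i) ^ 2 * (ω i) ^ 2))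

/-- Lemma 2 (Bull 2011, Lemma 4), spectral form: shrinking every lengthscale from
`φ i` to `φ' i ≤ φ i` increases the squared Gaussian-kernel RKHS norm by at most the
factor `∏ i, φ i / φ' i`. -/
theorem gaussRKHSNormSq_le_of_lengthscale_le {n : ℕ} (hn : 1 ≤ n)
    (f : EuclideanSpace ℝ (Fin n) → ℂ) (φ φ' : Fin n → ℝ)
    (hφ' : ∀ i, 0 < φ' i) (hle : ∀ i, φ' i ≤ φ i) :
    gaussRKHSNormSq φ' f ≤ ENNReal.ofReal (∏ i, φ i / φ' i) * gaussRKHSNormSq φ f := by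
  have hφ : ∀ i, 0 < φ i := fun i => (hφ' i).trans_le (hle i)
  have hP : 0 < ∏ i, φ i := Finset.prod_pos fun i _ => hφ i
  have hP' : 0 < ∏ i, φ' i := Finset.prod_pos fun i _ => hφ' i
  unfold gaussRKHSNormSq
  rw [← lintegral_const_mul' _ _ ENNReal.ofReal_ne_top, Finset.prod_div_distrib]
  refine lintegral_mono fun ω => ?_
  dsimp only
  rw [mul_left_comm, ← ENNReal.ofReal_mul (by positivity), ← mul_assoc, div_mul_eq_mul_div (∏ i, φ i),
    mul_inv_cancel₀ hP.ne', one_div (∏ i, φ' i)]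
  gcongr with i
  · exact (hφ' i).le
  · exact hle i
end

section
/- Let n ≥ 1 and let f : EuclideanSpace ℝ (Fin n) → ℂ. For a vector of lengthscales φ ∈ (Fin n → ℝ) with φ i > 0 for all i, define N φ f := ∫⁻ ω, ‖𝓕 f ω‖² · (∏ i, φ i)⁻¹ · exp ((1/2) · ∑ i, (φ i)² · (ω i)²) dω, where 𝓕 f denotes the Fourier transform of f on EuclideanSpace ℝ (Fin n). If N φ f < ∞ and φ' satisfies 0 < φ' i ≤ φ i for all i, then N φ' f < ∞. -/
open MeasureTheory Real
open scoped FourierTransform ENNReal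

/-- Shrinking the lengthscales increases the squared norm by at most the ratio of their products. -/
lemma gaussRKHSNormSq_le_mul {n : ℕ} (f : EuclideanSpace ℝ (Fin n) → ℂ) {φ φ' : Fin n → ℝ}
    (hφ' : ∀ i, 0 < φ' i) (hle : ∀ i, φ' i ≤ φ i) :
    gaussRKHSNormSq φ' f ≤
      ENNReal.ofReal ((∏ i, φ i) * (∏ i, φ' i)⁻¹) * gaussRKHSNormSq φ f := by
  have hP : 0 < ∏ i, φ i := Finset.prod_pos fun i _ => (hφ' i).trans_le (hle i)
  have hP' : 0 < ∏ i, φ' i := Finset.prod_pos fun i _ => hφ' i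
  unfold gaussRKHSNormSq
  rw [← lintegral_const_mul' _ _ ENNReal.ofReal_ne_top]
  refine lintegral_mono fun ω => ?_
  rw [mul_left_comm, ← ENNReal.ofReal_mul (by positivity)]
  gcongr _ * ENNReal.ofReal ?_
  calc (∏ i, φ' i)⁻¹ * Real.exp (1 / 2 * ∑ i, φ' i ^ 2 * ω i ^ 2)
      ≤ (∏ i, φ' i)⁻¹ * Real.exp (1 / 2 * ∑ i, φ i ^ 2 * ω i ^ 2) := by
        gcongr with i
        · exact (hφ' i).le
        · exact hle i
    _ = _ := by field_simp

/-- Membership statement of Lemma 2 (Bull 2011, Lemma 4): if `f` lies in the RKHS of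
the Gaussian kernel with lengthscales `φ` (finite spectral squared norm), then it lies
in the RKHS of the Gaussian kernel with any componentwise smaller positive
lengthscales `φ'`. -/
theorem gaussRKHSNormSq_lt_top_of_lengthscale_le {n : ℕ} (hn : 1 ≤ n)
    (f : EuclideanSpace ℝ (Fin n) → ℂ) (φ φ' : Fin n → ℝ)
    (hφ : ∀ i, 0 < φ i) (hfin : gaussRKHSNormSq φ f < ⊤)
    (hφ' : ∀ i, 0 < φ' i) (hle : ∀ i, φ' i ≤ φ i) :
    gaussRKHSNormSq φ' f < ⊤ := by
  exact (gaussRKHSNormSq_le_mul f hφ' hle).trans_lt (ENNReal.mul_lt_top ENNReal.ofReal_lt_top hfin)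
end
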